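/- (Remark 2.2.2, generalized coercivity) Let α ∈ ℝ satisfy α ∉ {|k|² : k ∈ 2πℤ² \ {0}}, and let W : ℝ → ℝ be continuous such that W(t) ≥ −C_α t² − c for all t ∈ ℝ, where c > 0 and C_α > 0 satisfies C_α < 2π² inf_{k ∈ 2πℤ², k≠0} (α/|k|² − 1)². Then there exist constants C, ε, h₀ > 0 and a constant C' ≥ 0 (depending only on α, m, c, C_α) such that for every L ∈ (1−ε, 1+ε), every h ∈ (0, h₀) and every φ ∈ V: F_{L,h}(φ) ≥ C( ‖φ − m‖²_{H²(Ω)} + h⁻⁴ ∫_Ω (∂₃φ)² dx ) − C'. -/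

import Mathlib

open MeasureTheory Filter Real

noncomputable section

abbrev Pt (d : ℕ) := Fin d → ℝ

/-- partial derivative in direction `i` -/
def pd {d : ℕ} (i : Fin d) (f : Pt d → ℝ) (x : Pt d) : ℝ := fderiv ℝ f x (Pi.single i 1)

/-- second partial derivative ∂ᵢ∂ⱼ -/
def pd2 {d : ℕ} (i j : Fin d) (f : Pt d → ℝ) : Pt d → ℝ := pd i (pd j f)

/-- the unit cube, the fundamental domain of the torus -/
def cube (d : ℕ) : Set (Pt d) := Set.Icc 0 1

/-- in-plane Laplacian Δ' = ∂₁₁ + ∂₂₂ -/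
def lap' (f : Pt 3 → ℝ) (x : Pt 3) : ℝ := pd2 0 0 f x + pd2 1 1 f x

/-- 1-periodicity in the two in-plane variables -/
def InPlanePeriodic (f : Pt 3 → ℝ) : Prop :=
  ∀ x : Pt 3, f (x + Pi.single 0 1) = f x ∧ f (x + Pi.single 1 1) = f x

structure MemV (m : ℝ) (f : Pt 3 → ℝ) : Prop where
  smooth : ContDiff ℝ 2 f
  periodic : InPlanePeriodic f
  bc : ∀ x : Pt 3, x 2 = 0 ∨ x 2 = 1 → pd 2 f x = 0
  mass : (∫ x in cube 3, f x) = m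

def MemVstar (m : ℝ) (f : Pt 3 → ℝ) : Prop :=
  MemV m f ∧ ∀ x ∈ cube 3, pd 2 f x = 0

/-- rescaled energy F_{L,h} -/
def FLh (α : ℝ) (W : ℝ → ℝ) (L h : ℝ) (f : Pt 3 → ℝ) : ℝ :=
  ∫ x in cube 3,
    ((1/2) * (α * f x + (1/L^2) * lap' f x + (1/(L^2*h^2)) * pd2 2 2 f x)^2 + W (f x))

def H2normSq (f : Pt 3 → ℝ) : ℝ :=
  ∫ x in cube 3, ((f x)^2 + ∑ i, (pd i f x)^2 + ∑ i, ∑ j, (pd2 i j f x)^2)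

def H2inner (f g : Pt 3 → ℝ) : ℝ :=
  ∫ x in cube 3,
    (f x * g x + ∑ i, pd i f x * pd i g x + ∑ i, ∑ j, pd2 i j f x * pd2 i j g x)

/-- weak convergence in H²(Ω): boundedness plus convergence of inner products
against all test functions in H² (C² functions being dense). -/
def WeakH2 (fs : ℕ → Pt 3 → ℝ) (f : Pt 3 → ℝ) : Prop :=
  (∃ M : ℝ, ∀ n, H2normSq (fs n) ≤ M) ∧
  ∀ g : Pt 3 → ℝ, ContDiff ℝ 2 g →
    Tendsto (fun n => H2inner (fs n) g) atTop (nhds (H2inner f g))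

/-- α ∉ {|k|² : k ∈ 2πℤ² \ {0}} -/
def AlphaAdmissible (α : ℝ) : Prop :=
  ∀ k : ℤ × ℤ, k ≠ 0 → α ≠ 4*π^2*((k.1 : ℝ)^2 + (k.2 : ℝ)^2)

/-- W continuous and liminf_{|s|→∞} W(s) > -∞ -/
def WAdmissible (W : ℝ → ℝ) : Prop :=
  Continuous W ∧ Filter.IsBoundedUnder (· ≥ ·) (Filter.cocompact ℝ) W

open Classical in
/-- limit functional F_* (with value +∞ outside V_*) -/
def FStar (m α : ℝ) (W : ℝ → ℝ) (f : Pt 3 → ℝ) : EReal :=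
  if MemVstar m f then
    (((∫ x in cube 3, ((1/2) * (α * f x + lap' f x)^2 + W (f x))) : ℝ) : EReal)
  else ⊤


/-- insert coordinate `t` at position `i` -/
abbrev ins {d : ℕ} (i : Fin (d+1)) (t : ℝ) (y : Pt d) : Pt (d+1) :=
  Fin.insertNth (α := fun _ => ℝ) i t y

lemma cube_measurable (d : ℕ) : MeasurableSet (cube d) := measurableSet_Icc

lemma cube_compact (d : ℕ) : IsCompact (cube d) := isCompact_Icc

lemma cube_vol (d : ℕ) : volume (cube d) = 1 := by
  unfold cube
  rw [Real.volume_Icc_pi]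
  simp

instance cube_prob (d : ℕ) : IsProbabilityMeasure (volume.restrict (cube d)) :=
  ⟨by rw [Measure.restrict_apply_univ, cube_vol]⟩

lemma cont_int {d : ℕ} {G : Pt d → ℝ} (hG : Continuous G) :
    IntegrableOn G (cube d) := hG.continuousOn.integrableOn_compact (cube_compact d)

lemma ins_cont {d : ℕ} (i : Fin (d+1)) : Continuous (fun p : ℝ × Pt d => ins i p.1 p.2) := by
  refine continuous_pi (fun j => ?_)
  rcases Fin.eq_self_or_eq_succAbove i j with rfl | ⟨k, rfl⟩
  · simpa [ins] using continuous_fst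
  · simp only [ins, Fin.insertNth_apply_succAbove]
    fun_prop

lemma cube_fubini {d : ℕ} (i : Fin (d+1)) {G : Pt (d+1) → ℝ} (hG : Continuous G) :
    ∫ x in cube (d+1), G x = ∫ t in (0:ℝ)..1, ∫ y in cube d, G (ins i t y) := by
  set e : ℝ × Pt d ≃ᵐ Pt (d+1) := (MeasurableEquiv.piFinSuccAbove (fun _ => ℝ) i).symm
  have hem : MeasurePreserving e :=
    (volume_preserving_piFinSuccAbove (fun _ : Fin (d + 1) => ℝ) i).symm _
  have heπ : (e ⁻¹' Set.Icc 0 1) = Set.Icc (0:ℝ) 1 ×ˢ Set.Icc (0 : Pt d) 1 :=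
    ((Fin.insertNthOrderIso (fun _ => ℝ) i).preimage_Icc _ _).trans (Set.Icc_prod_eq _ _)
  unfold cube
  rw [← hem.map_eq, setIntegral_map_equiv, heπ, Measure.volume_eq_prod,
    setIntegral_prod, intervalIntegral.integral_of_le zero_le_one, integral_Icc_eq_integral_Ioc]
  · rfl
  · refine ContinuousOn.integrableOn_compact (isCompact_Icc.prod isCompact_Icc) ?_
    exact (hG.comp (ins_cont i)).continuousOn

lemma cube_fubini' {d : ℕ} (i : Fin (d+1)) {G : Pt (d+1) → ℝ} (hG : Continuous G) :
    ∫ x in cube (d+1), G x = ∫ y in cube d, ∫ t in (0:ℝ)..1, G (ins i t y) := by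
  rw [cube_fubini i hG]
  have h := hG.comp (ins_cont i)
  rw [intervalIntegral.integral_of_le zero_le_one, integral_integral_swap]
  · simp_rw [intervalIntegral.integral_of_le zero_le_one]
  · rw [Measure.prod_restrict, ← Measure.volume_eq_prod]
    change IntegrableOn _ _ _
    exact (h.continuousOn.integrableOn_compact (isCompact_Icc.prod (cube_compact d))).mono_set
      (Set.prod_mono Set.Ioc_subset_Icc_self subset_rfl)

lemma line_hasDeriv {d : ℕ} (i : Fin d) {f : Pt d → ℝ} (hf : Differentiable ℝ f) (x : Pt d) (s : ℝ) :
    HasDerivAt (fun s : ℝ => f (x + s • Pi.single i 1)) (pd i f (x + s • Pi.single i 1)) s := by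
  have h1 : HasDerivAt (fun s : ℝ => x + s • (Pi.single i 1 : Pt d)) (Pi.single i 1) s := by
    simpa using ((hasDerivAt_id s).smul_const (Pi.single i 1 : Pt d)).const_add x
  exact (hf _).hasFDerivAt.comp_hasDerivAt s h1

lemma ins_eq {d : ℕ} (i : Fin (d+1)) (t : ℝ) (y : Pt d) :
    ins i t y = ins i 0 y + t • Pi.single i 1 := by
  ext j
  rcases Fin.eq_self_or_eq_succAbove i j with rfl | ⟨k, rfl⟩ <;> simp [ins]

lemma ins_hasDeriv {d : ℕ} (i : Fin (d+1)) {f : Pt (d+1) → ℝ} (hf : Differentiable ℝ f)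
    (y : Pt d) (s : ℝ) :
    HasDerivAt (fun s : ℝ => f (ins i s y)) (pd i f (ins i s y)) s := by
  have := line_hasDeriv i hf (ins i 0 y) s
  simpa only [← ins_eq] using this

lemma pd_contDiff {d : ℕ} (i : Fin d) {f : Pt d → ℝ} {n : ℕ} (hf : ContDiff ℝ (n+1 : ℕ) f) :
    ContDiff ℝ n (pd i f) := by
  unfold pd
  exact (hf.fderiv_right (m := n) (by norm_cast)).clm_apply contDiff_const

lemma pd_cont {d : ℕ} (i : Fin d) {f : Pt d → ℝ} (hf : ContDiff ℝ 1 f) :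
    Continuous (pd i f) := by
  have := pd_contDiff (n := 0) i (f := f) (by simpa using hf)
  exact this.continuous

lemma pd_C1 {d : ℕ} (i : Fin d) {f : Pt d → ℝ} (hf : ContDiff ℝ 2 f) :
    ContDiff ℝ 1 (pd i f) := by
  have := pd_contDiff (n := 1) i (f := f) (by exact_mod_cast hf)
  exact_mod_cast this

lemma pd2_cont {d : ℕ} (i j : Fin d) {f : Pt d → ℝ} (hf : ContDiff ℝ 2 f) :
    Continuous (pd2 i j f) := pd_cont i (pd_C1 j hf)

lemma pd2_symm {d : ℕ} (i j : Fin d) {f : Pt d → ℝ} (hf : ContDiff ℝ 2 f) :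
    pd2 i j f = pd2 j i f := by
  ext x
  have key : ∀ i j : Fin d, pd2 i j f x
      = fderiv ℝ (fderiv ℝ f) x (Pi.single i 1) (Pi.single j 1) := by
    intro i j
    have hd : DifferentiableAt ℝ (fderiv ℝ f) x :=
      ((hf.fderiv_right (m := 1) (by norm_num)).differentiable (by norm_num)) x
    unfold pd2 pd
    rw [fderiv_clm_apply hd (by fun_prop)]
    simp
  rw [key, key]
  have := hf.contDiffAt.isSymmSndFDerivAt (x := x) (by simp)
  exact this.eq _ _

lemma integral_pd_eq_zero {d : ℕ} (i : Fin (d+1)) {H : Pt (d+1) → ℝ} (hH : ContDiff ℝ 1 H)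
    (hb : ∀ y, H (ins i 1 y) = H (ins i 0 y)) : ∫ x in cube (d+1), pd i H x = 0 := by
  rw [cube_fubini' i (pd_cont i hH)]
  have : ∀ y : Pt d, ∫ t in (0:ℝ)..1, pd i H (ins i t y) = 0 := by
    intro y
    rw [intervalIntegral.integral_eq_sub_of_hasDerivAt
      (fun t _ => ins_hasDeriv i (hH.differentiable (by norm_num)) y t), hb, sub_self]
    apply Continuous.intervalIntegrable
    exact (pd_cont i hH).comp ((ins_cont i).comp (by fun_prop : Continuous fun t : ℝ => (t, y)))
  simp [this]

lemma pd_mul {d : ℕ} (i : Fin d) {u v : Pt d → ℝ} (hu : Differentiable ℝ u)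
    (hv : Differentiable ℝ v) (x : Pt d) :
    pd i (fun x => u x * v x) x = pd i u x * v x + u x * pd i v x := by
  unfold pd
  rw [fderiv_fun_mul (hu x) (hv x)]
  simp; ring

lemma by_parts {d : ℕ} (i : Fin (d+1)) {u v : Pt (d+1) → ℝ} (hu : ContDiff ℝ 1 u)
    (hv : ContDiff ℝ 1 v)
    (hb : ∀ y, u (ins i 1 y) * v (ins i 1 y) = u (ins i 0 y) * v (ins i 0 y)) :
    ∫ x in cube (d+1), pd i u x * v x = - ∫ x in cube (d+1), u x * pd i v x := by
  have h := integral_pd_eq_zero i (hu.mul hv) hb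
  simp_rw [pd_mul i (hu.differentiable (by norm_num)) (hv.differentiable (by norm_num))] at h
  rw [integral_add] at h
  · linarith
  · exact cont_int ((pd_cont i hu).mul hv.continuous)
  · exact cont_int (hu.continuous.mul (pd_cont i hv))

lemma pd_shift {d : ℕ} (j : Fin d) (f : Pt d → ℝ) (v : Pt d) (x : Pt d) :
    pd j (fun x => f (x + v)) x = pd j f (x + v) := by
  unfold pd
  rw [fderiv_comp_add_right]

/-- periodicity in direction `i` -/
def PerI {d : ℕ} (i : Fin d) (f : Pt d → ℝ) : Prop := ∀ x, f (x + Pi.single i 1) = f x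

lemma PerI.pd {d : ℕ} {i : Fin d} {f : Pt d → ℝ} (hf : PerI i f) (j : Fin d) : PerI i (pd j f) := by
  intro x
  rw [← pd_shift]
  congr 1
  ext y
  exact hf y

lemma PerI.mul {d : ℕ} {i : Fin d} {f g : Pt d → ℝ} (hf : PerI i f) (hg : PerI i g) :
    PerI i (fun x => f x * g x) := by
  intro x
  simp only [hf x, hg x]

lemma PerI.shift {d : ℕ} {i : Fin d} {f : Pt d → ℝ} (hf : PerI i f) (v : Pt d) :
    PerI i (fun x => f (x + v)) := by
  intro x
  change f (x + Pi.single i 1 + v) = f (x + v)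
  rw [add_right_comm, hf]

lemma PerI.face {d : ℕ} {i : Fin (d+1)} {f : Pt (d+1) → ℝ} (hf : PerI i f) (y : Pt d) :
    f (ins i 1 y) = f (ins i 0 y) := by
  rw [ins_eq i 1, one_smul, hf]

lemma shift_integral {d : ℕ} {i : Fin (d+1)} {G : Pt (d+1) → ℝ} (hG : Continuous G)
    (hp : PerI i G) (s : ℝ) :
    ∫ x in cube (d+1), G (x + s • Pi.single i 1) = ∫ x in cube (d+1), G x := by
  have hF := cube_fubini' i (G := fun x => G (x + s • Pi.single i 1)) (by fun_prop)
  refine hF.trans ?_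
  rw [cube_fubini' i hG]
  congr 1
  ext y
  have h1 : ∀ t, ins i t y + s • Pi.single i 1 = ins i (t + s) y := by
    intro t
    rw [ins_eq i t, ins_eq i (t+s), add_smul, add_assoc]
  have hper : Function.Periodic (fun t => G (ins i t y)) 1 := by
    intro t
    have := hp (ins i t y)
    have h2 : ins i t y + Pi.single i 1 = ins i (t + 1) y := by
      rw [ins_eq i t, ins_eq i (t+1), add_smul, add_assoc, one_smul]
    rw [h2] at this
    exact this
  simp only [h1]
  rw [intervalIntegral.integral_comp_add_right (fun t => G (ins i t y)) s]
  have := hper.intervalIntegral_add_eq s 0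
  simpa [add_comm] using this

lemma deriv_under {d : ℕ} (i : Fin d) {g b : Pt d → ℝ} (hg : ContDiff ℝ 1 g) (hb : Continuous b) :
    HasDerivAt (fun s : ℝ => ∫ x in cube d, g (x + s • Pi.single i 1) * b x)
      (∫ x in cube d, pd i g x * b x) 0 := by
  have hcont : Continuous (fun p : ℝ × Pt d => pd i g (p.2 + p.1 • Pi.single i 1) * b p.2) := by
    have := pd_cont i hg
    fun_prop
  obtain ⟨M, hM⟩ := ((isCompact_Icc (a := (-1:ℝ)) (b := 1)).prod
    (cube_compact d)).exists_bound_of_continuousOn hcont.continuousOn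
  have := (hasDerivAt_integral_of_dominated_loc_of_deriv_le (μ := volume.restrict (cube d))
    (F := fun (s : ℝ) x => g (x + s • Pi.single i 1) * b x)
    (F' := fun (s : ℝ) x => pd i g (x + s • Pi.single i 1) * b x)
    (bound := fun _ => M) (x₀ := 0) (s := Set.Icc (-1) 1)
    (Icc_mem_nhds (by norm_num) (by norm_num)) ?_ ?_ ?_ ?_ ?_ ?_).2
  · simpa using this
  · refine Eventually.of_forall (fun s => ?_)
    have := hg.continuous
    exact Continuous.aestronglyMeasurable (by fun_prop)
  · have := hg.continuous
    exact cont_int (by fun_prop)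
  · have := pd_cont i hg
    exact Continuous.aestronglyMeasurable (by fun_prop)
  · filter_upwards [ae_restrict_mem (cube_measurable d)] with x hx s hs
    exact hM (s, x) ⟨hs, hx⟩
  · exact integrable_const M
  · refine Eventually.of_forall (fun x s _ => ?_)
    exact (line_hasDeriv i (hg.differentiable (by norm_num)) x s).mul_const _

/-- ∫ ∂ᵢᵢf ∂ⱼⱼf = ∫ (∂ⱼᵢf)² -/
lemma hess_identity {d : ℕ} (i j : Fin (d+1)) {f : Pt (d+1) → ℝ} (hf : ContDiff ℝ 2 f)
    (hi : PerI i f)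
    (hb : ∀ (s : ℝ) y, pd i f (ins j 1 y + s • Pi.single i 1) * pd j f (ins j 1 y)
      = pd i f (ins j 0 y + s • Pi.single i 1) * pd j f (ins j 0 y)) :
    ∫ x in cube (d+1), pd2 i i f x * pd2 j j f x = ∫ x in cube (d+1), (pd2 j i f x)^2 := by
  have e : ∀ s : ℝ, ∫ x in cube (d+1), pd i f (x + s • Pi.single i 1) * pd2 j j f x
      = - ∫ x in cube (d+1), pd j f (x + (-s) • Pi.single i 1) * pd2 j i f x := by
    intro s
    have h1 : ContDiff ℝ 1 (fun x => pd i f (x + s • Pi.single i 1)) :=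
      (pd_C1 i hf).comp (by fun_prop)
    have h2 := by_parts j h1 (pd_C1 j hf) (hb s)
    simp_rw [pd_shift] at h2
    have h3 : ∫ x in cube (d+1), pd i f (x + s • Pi.single i 1) * pd2 j j f x
      = - ∫ x in cube (d+1), pd2 j i f (x + s • Pi.single i 1) * pd j f x := by
      unfold pd2 at *
      linarith
    rw [h3]
    have h4 := shift_integral (i := i) (G := fun x => pd j f (x + (-s) • Pi.single i 1) * pd2 j i f x)
      ?_ ?_ s
    · rw [← h4]
      congr 2
      ext x
      have : x + s • Pi.single i 1 + -s • Pi.single i (1:ℝ) = x := by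
        rw [neg_smul, add_neg_cancel_right]
      rw [this, mul_comm]
    · have := (pd_C1 j hf).continuous
      have := pd2_cont j i hf
      fun_prop
    · exact ((hi.pd j).shift _).mul ((hi.pd i).pd j)
  have d1 := deriv_under i (pd_C1 i hf) (pd2_cont j j hf)
  have d2 := deriv_under i (pd_C1 j hf) (pd2_cont j i hf)
  simp_rw [e] at d1
  have d3 : HasDerivAt (fun s : ℝ => - ∫ x in cube (d+1), pd j f (x + (-s) • Pi.single i 1) * pd2 j i f x)
      (∫ x in cube (d+1), pd i (pd j f) x * pd2 j i f x) 0 := by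
    have hn : HasDerivAt (fun s : ℝ => -s) (-1) 0 := by
      exact hasDerivAt_neg (0:ℝ)
    have d2' : HasDerivAt (fun s : ℝ => ∫ x in cube (d+1), pd j f (x + s • Pi.single i 1) * pd2 j i f x)
      (∫ x in cube (d+1), pd i (pd j f) x * pd2 j i f x) (-0) := by simpa using d2
    have := (HasDerivAt.comp (0:ℝ) d2' hn).neg
    rw [mul_neg_one, neg_neg] at this
    exact this
  have := d1.unique d3
  change ∫ x in cube (d+1), pd i (pd i f) x * pd2 j j f x = _
  rw [this]
  congr 1
  ext x
  have := congrFun (pd2_symm i j hf) x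
  change pd2 i j f x * _ = _
  rw [this, sq]

lemma jensen_sq {X : Type*} [MeasurableSpace X] (μ : Measure X) [IsProbabilityMeasure μ]
    {k : X → ℝ} (h1 : Integrable k μ) (h2 : Integrable (fun x => (k x)^2) μ) :
    (∫ x, k x ∂μ)^2 ≤ ∫ x, (k x)^2 ∂μ := by
  set c := ∫ x, k x ∂μ with hc
  have h0 : 0 ≤ ∫ x, (k x - c)^2 ∂μ := integral_nonneg (fun x => sq_nonneg _)
  have : ∫ x, (k x - c)^2 ∂μ = ∫ x, ((k x)^2 - 2 * c * k x + c^2) ∂μ := by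
    congr 1; ext x; ring
  have h3 : Integrable (fun x => (k x)^2 - 2 * c * k x) μ := h2.sub (h1.const_mul _)
  rw [this, integral_add h3 (integrable_const _), integral_sub h2 (h1.const_mul _),
    integral_const_mul, integral_const] at h0
  simp at h0
  rw [← hc] at h0
  nlinarith

instance I_prob : IsProbabilityMeasure (volume.restrict (Set.Ioc (0:ℝ) 1)) :=
  ⟨by simp⟩

lemma cont_intI {k : ℝ → ℝ} (hk : Continuous k) : Integrable k (volume.restrict (Set.Ioc (0:ℝ) 1)) := by
  have := hk.intervalIntegrable (μ := volume) 0 1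
  rwa [intervalIntegrable_iff_integrableOn_Ioc_of_le zero_le_one] at this

lemma osc_1d {g g' : ℝ → ℝ} (hg : ∀ t, HasDerivAt g (g' t) t) (hc : Continuous g') {s t : ℝ}
    (hs : s ∈ Set.Icc (0:ℝ) 1) (ht : t ∈ Set.Icc (0:ℝ) 1) :
    (g s - g t)^2 ≤ ∫ r in (0:ℝ)..1, (g' r)^2 := by
  have h1 : g s - g t = ∫ r in t..s, g' r :=
    (intervalIntegral.integral_eq_sub_of_hasDerivAt (fun r _ => hg r)
      (hc.intervalIntegrable _ _)).symm
  have hsub : Set.uIoc t s ⊆ Set.Ioc 0 1 := by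
    intro r hr
    rw [Set.mem_uIoc] at hr
    rcases hr with hr | hr
    · exact ⟨ht.1.trans_lt hr.1, hr.2.trans hs.2⟩
    · exact ⟨hs.1.trans_lt hr.1, hr.2.trans ht.2⟩
  have h2 : |g s - g t| ≤ ∫ r in Set.Ioc (0:ℝ) 1, |g' r| := by
    rw [h1]
    have := intervalIntegral.norm_integral_le_integral_norm_uIoc (f := g') (a := t) (b := s) (μ := volume)
    refine this.trans ?_
    exact setIntegral_mono_set (cont_intI hc.abs) (Eventually.of_forall fun x => abs_nonneg _)
      hsub.eventuallyLE
  have h3 := jensen_sq (volume.restrict (Set.Ioc (0:ℝ) 1)) (cont_intI hc.abs) (cont_intI (hc.abs.pow 2))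
  simp only [sq_abs] at h3
  rw [intervalIntegral.integral_of_le zero_le_one]
  refine le_trans ?_ h3
  rw [← sq_abs]
  exact pow_le_pow_left₀ (abs_nonneg _) h2 2

lemma ins_cont_left {d : ℕ} (i : Fin (d+1)) (y : Pt d) : Continuous (fun t => ins i t y) :=
  (ins_cont i).comp (by fun_prop : Continuous fun t : ℝ => (t, y))

lemma ins_cont_right {d : ℕ} (i : Fin (d+1)) (t : ℝ) : Continuous (fun y => ins i t y) :=
  (ins_cont i).comp (by fun_prop : Continuous fun y : Pt d => (t, y))

lemma inner_cont {d : ℕ} (i : Fin (d+1)) {G : Pt (d+1) → ℝ} (hG : Continuous G) :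
    Continuous (fun t => ∫ y in cube d, G (ins i t y)) := by
  have h : Continuous (Function.uncurry fun (t : ℝ) (y : Pt d) => G (ins i t y)) :=
    hG.comp (ins_cont i)
  exact continuous_parametric_integral_of_continuous h (cube_compact d)

lemma inner_cont' {d : ℕ} (i : Fin (d+1)) {G : Pt (d+1) → ℝ} (hG : Continuous G) :
    Continuous (fun y => ∫ t in (0:ℝ)..1, G (ins i t y)) := by
  have h : Continuous (Function.uncurry fun (y : Pt d) (t : ℝ) => G (ins i t y)) :=
    (hG.comp (ins_cont i)).comp continuous_swap
  exact intervalIntegral.continuous_parametric_intervalIntegral_of_continuous' h 0 1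

lemma poincare0 {d : ℕ} (i : Fin (d+1)) {w : Pt (d+1) → ℝ} (hw : ContDiff ℝ 1 w)
    (h0 : ∀ y, w (ins i 0 y) = 0) :
    ∫ x in cube (d+1), (w x)^2 ≤ ∫ x in cube (d+1), (pd i w x)^2 := by
  have c1 : Continuous fun x => (w x)^2 := hw.continuous.pow 2
  have c2 : Continuous fun x => (pd i w x)^2 := (pd_cont i hw).pow 2
  rw [cube_fubini i c1, cube_fubini' i c2, intervalIntegral.integral_of_le zero_le_one]
  calc _ ≤ ∫ t in Set.Ioc (0:ℝ) 1, ∫ y in cube d, ∫ t in (0:ℝ)..1, (pd i w (ins i t y))^2 := by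
        refine setIntegral_mono_on (cont_intI (inner_cont i c1)) (integrable_const _)
          measurableSet_Ioc ?_
        intro t ht
        refine setIntegral_mono (cont_int (c1.comp (ins_cont_right i t))) (cont_int (inner_cont' i c2)) ?_
        intro y
        have := osc_1d (fun t => ins_hasDeriv i (hw.differentiable (by norm_num)) y t)
          ((pd_cont i hw).comp (ins_cont_left i y)) (Set.Ioc_subset_Icc_self ht)
          (⟨le_rfl, zero_le_one⟩ : (0:ℝ) ∈ Set.Icc (0:ℝ) 1)
        simpa [h0 y] using this
    _ = _ := by simp

lemma mean_est {d : ℕ} (i : Fin (d+1)) {f : Pt (d+1) → ℝ} (hf : ContDiff ℝ 1 f) :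
    ∫ t in (0:ℝ)..1, (∫ y in cube d, f (ins i t y))^2
      ≤ (∫ x in cube (d+1), f x)^2 + ∫ x in cube (d+1), (pd i f x)^2 := by
  set U : ℝ → ℝ := fun t => ∫ y in cube d, f (ins i t y) with hU
  set m := ∫ x in cube (d+1), f x with hm
  set D := ∫ x in cube (d+1), (pd i f x)^2 with hD
  have cU : Continuous U := inner_cont i hf.continuous
  have c2 : Continuous fun x => (pd i f x)^2 := (pd_cont i hf).pow 2
  have mU : ∫ t in Set.Ioc (0:ℝ) 1, U t = m := by
    rw [hm, cube_fubini i hf.continuous, intervalIntegral.integral_of_le zero_le_one]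
  have hDf : D = ∫ y in cube d, ∫ t in (0:ℝ)..1, (pd i f (ins i t y))^2 := cube_fubini' i c2
  have pt : ∀ s ∈ Set.Icc (0:ℝ) 1, ∀ t ∈ Set.Icc (0:ℝ) 1, (U s - U t)^2 ≤ D := by
    intro s hs t ht
    have cs := hf.continuous.comp (ins_cont_right i s)
    have ct := hf.continuous.comp (ins_cont_right i t)
    have : U s - U t = ∫ y in cube d, (f (ins i s y) - f (ins i t y)) :=
      (integral_sub (cont_int cs) (cont_int ct)).symm
    rw [this]
    refine (jensen_sq _ (cont_int (cs.sub ct)) (cont_int ((cs.sub ct).pow 2))).trans ?_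
    rw [hDf]
    refine setIntegral_mono (cont_int ((cs.sub ct).pow 2)) (cont_int (inner_cont' i c2)) ?_
    intro y
    exact osc_1d (fun t => ins_hasDeriv i (hf.differentiable (by norm_num)) y t)
          ((pd_cont i hf).comp (ins_cont_left i y)) hs ht
  have pt2 : ∀ s ∈ Set.Icc (0:ℝ) 1, (U s - m)^2 ≤ D := by
    intro s hs
    have : U s - m = ∫ t in Set.Ioc (0:ℝ) 1, (U s - U t) := by
      rw [integral_sub (integrable_const _) (cont_intI cU), mU]; simp
    rw [this]
    refine (jensen_sq _ (cont_intI (by fun_prop)) (cont_intI (by fun_prop))).trans ?_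
    calc _ ≤ ∫ t in Set.Ioc (0:ℝ) 1, D := by
          refine setIntegral_mono_on (cont_intI (by fun_prop)) (integrable_const _) measurableSet_Ioc ?_
          intro t ht
          exact pt s hs t (Set.Ioc_subset_Icc_self ht)
      _ = D := by simp
  rw [intervalIntegral.integral_of_le zero_le_one]
  have : ∫ t in Set.Ioc (0:ℝ) 1, (U t)^2
      = ∫ t in Set.Ioc (0:ℝ) 1, ((U t - m)^2 + 2 * m * U t - m^2) := by
    congr 1; ext t; ring
  change ∫ t in Set.Ioc (0:ℝ) 1, (U t)^2 ≤ _
  rw [this, integral_sub (cont_intI (by fun_prop)) (integrable_const _),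
    integral_add (cont_intI (by fun_prop)) (cont_intI (by fun_prop)), integral_const_mul, mU]
  have : ∫ t in Set.Ioc (0:ℝ) 1, (U t - m)^2 ≤ D := by
    calc _ ≤ ∫ t in Set.Ioc (0:ℝ) 1, D := by
          refine setIntegral_mono_on (cont_intI (by fun_prop)) (integrable_const _) measurableSet_Ioc ?_
          intro t ht
          exact pt2 t (Set.Ioc_subset_Icc_self ht)
      _ = D := by simp
  simp
  nlinarith

section parseval
open UnitAddTorus

local instance msUC : MeasureSpace UnitAddCircle := ⟨AddCircle.haarAddCircle⟩

local instance haarUC : Measure.IsAddHaarMeasure (volume : Measure UnitAddCircle) :=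
  inferInstanceAs (Measure.IsAddHaarMeasure AddCircle.haarAddCircle)

local instance probUC : IsProbabilityMeasure (volume : Measure UnitAddCircle) :=
  inferInstanceAs (IsProbabilityMeasure AddCircle.haarAddCircle)

/-- phase 2π n·y -/
def phase {d : ℕ} (n : Fin d → ℤ) (y : Pt d) : ℝ := ∑ i, (2 * π * (n i : ℝ)) * y i

lemma box_ae (d : ℕ) : ({x : Pt d | ∀ i, x i ∈ Set.Ioc ((0 : Pt d) i) ((0 : Pt d) i + 1)} : Set (Pt d))
    =ᵐ[volume] cube d := by
  have h : ({x : Pt d | ∀ i, x i ∈ Set.Ioc ((0 : Pt d) i) ((0 : Pt d) i + 1)} : Set (Pt d))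
    = Set.pi Set.univ (fun i => Set.Ioc ((0 : Pt d) i) ((1 : Pt d) i)) := by
    ext x; simp
  rw [h]
  exact Measure.univ_pi_Ioc_ae_eq_Icc

lemma mFourier_mk {d : ℕ} (n : Fin d → ℤ) (y : Pt d) :
    mFourier n (fun i => (y i : UnitAddCircle)) = Complex.exp (Complex.I * (phase n y : ℝ)) := by
  simp only [mFourier, ContinuousMap.coe_mk, fourier_coe_apply, phase]
  rw [← Complex.exp_sum]
  congr 1
  push_cast
  rw [Finset.mul_sum]
  refine Finset.sum_congr rfl fun i _ => ?_
  simp; ring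

lemma phase_cont {d : ℕ} (n : Fin d → ℤ) : Continuous (phase n) := by
  unfold phase; fun_prop

lemma parseval {d : ℕ} {u : Pt d → ℝ} (hu : Continuous u) :
    HasSum (fun n : Fin d → ℤ => (∫ y in cube d, u y * Real.cos (phase n y))^2
      + (∫ y in cube d, u y * Real.sin (phase n y))^2) (∫ y in cube d, (u y)^2) := by
  let g : UnitAddTorus (Fin d) → ℂ := fun z => (u (fun i => (AddCircle.equivIoc 1 (0:ℝ) (z i)).1) : ℂ)
  have hgmk : ∀ y ∈ ({x : Pt d | ∀ i, x i ∈ Set.Ioc ((0 : Pt d) i) ((0 : Pt d) i + 1)} : Set (Pt d)),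
      g (fun i => (y i : UnitAddCircle)) = u y := by
    intro y hy
    simp only [g]
    congr 2
    ext i
    have h1 : y i ∈ Set.Ioc (0:ℝ) (0 + 1) := hy i
    have := (AddCircle.equivIoc 1 (0:ℝ)).apply_symm_apply ⟨y i, h1⟩
    exact congrArg Subtype.val this
  have hbm : MeasurableSet ({x : Pt d | ∀ i, x i ∈ Set.Ioc ((0 : Pt d) i) ((0 : Pt d) i + 1)} : Set (Pt d)) :=
    MeasurableSet.univ_pi' (fun i => measurableSet_Ioc)
  have hgm : Measurable g := by
    refine Complex.measurable_ofReal.comp (hu.measurable.comp ?_)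
    refine measurable_pi_lambda _ (fun i => ?_)
    exact measurable_subtype_coe.comp
      ((AddCircle.measurableEquivIoc 1 (0:ℝ)).measurable.comp (measurable_pi_apply i))
  obtain ⟨M, hM⟩ := (cube_compact d).exists_bound_of_continuousOn hu.continuousOn
  have hgL : MemLp g 2 (volume : Measure (UnitAddTorus (Fin d))) := by
    refine MemLp.of_bound hgm.aestronglyMeasurable M (Eventually.of_forall fun z => ?_)
    simp only [g, Complex.norm_real]
    refine hM _ ⟨fun i => ?_, fun i => ?_⟩
    · exact (AddCircle.equivIoc 1 (0:ℝ) (z i)).2.1.le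
    · simpa using (AddCircle.equivIoc 1 (0:ℝ) (z i)).2.2
  have hP := hasSum_sq_mFourierCoeff (hgL.toLp g)
  have e1 : ∫ t, ‖(hgL.toLp g : UnitAddTorus (Fin d) → ℂ) t‖^2 = ∫ y in cube d, (u y)^2 := by
    have : ∫ t, ‖(hgL.toLp g : UnitAddTorus (Fin d) → ℂ) t‖^2 = ∫ t, ‖g t‖^2 := by
      refine integral_congr_ae ?_
      filter_upwards [hgL.coeFn_toLp] with t ht
      rw [ht]
    rw [this, integral_preimage _ (0 : Pt d), setIntegral_congr_set (box_ae d).symm]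
    refine setIntegral_congr_fun hbm ?_
    intro y hy
    simp only
    rw [hgmk y hy]
    simp
  have e2 : ∀ n, ‖mFourierCoeff (hgL.toLp g : UnitAddTorus (Fin d) → ℂ) n‖^2 =
      (∫ y in cube d, u y * Real.cos (phase n y))^2
      + (∫ y in cube d, u y * Real.sin (phase n y))^2 := by
    intro n
    have h1 : mFourierCoeff (hgL.toLp g : UnitAddTorus (Fin d) → ℂ) n = mFourierCoeff g n := by
      unfold mFourierCoeff
      refine integral_congr_ae ?_
      filter_upwards [hgL.coeFn_toLp] with t ht
      rw [ht]
    have hp : ∀ y, phase (-n) y = - phase n y := by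
      intro y; simp [phase]
    have h2 : mFourierCoeff g n = ∫ y in cube d, (((u y * Real.cos (phase n y) : ℝ) : ℂ)
        + ((- (u y * Real.sin (phase n y)) : ℝ) : ℂ) * Complex.I) := by
      rw [mFourierCoeff_eq_integral _ _ (0 : Pt d), setIntegral_congr_set (box_ae d).symm]
      refine setIntegral_congr_fun hbm ?_
      intro y hy
      simp only
      rw [hgmk y hy, mFourier_mk, hp, mul_comm, Complex.exp_mul_I, smul_eq_mul]
      push_cast
      rw [Complex.cos_neg, Complex.sin_neg]
      ring
    have pc := phase_cont n
    have h3 : mFourierCoeff g n = ((∫ y in cube d, u y * Real.cos (phase n y) : ℝ) : ℂ)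
        + ((- ∫ y in cube d, u y * Real.sin (phase n y) : ℝ) : ℂ) * Complex.I := by
      rw [h2, integral_add, integral_mul_const, integral_complex_ofReal, integral_complex_ofReal,
        integral_neg]
      · exact (cont_int (G := fun y => u y * Real.cos (phase n y)) (by fun_prop)).ofReal
      · exact ((cont_int (G := fun y => - (u y * Real.sin (phase n y))) (by fun_prop)).ofReal).mul_const _
    rw [h1, h3, Complex.sq_norm, Complex.normSq_add_mul_I]
    ring
  rw [e1] at hP
  simp_rw [e2] at hP
  exact hP

end parseval

lemma phase_contDiff {d : ℕ} (n : Fin d → ℤ) {k : WithTop ℕ∞} : ContDiff ℝ k (phase n) := by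
  unfold phase; fun_prop

lemma phase_add {d : ℕ} (n : Fin d → ℤ) (x : Pt d) (i : Fin d) (s : ℝ) :
    phase n (x + s • Pi.single i 1) = phase n x + (2 * π * n i) * s := by
  unfold phase
  simp [mul_add, Finset.sum_add_distrib, Pi.single_apply]

lemma pd_of_line {d : ℕ} (i : Fin d) {f : Pt d → ℝ} (hf : Differentiable ℝ f) (x : Pt d) {c : ℝ}
    (h : HasDerivAt (fun s : ℝ => f (x + s • Pi.single i 1)) c 0) : pd i f x = c := by
  have := line_hasDeriv i hf x 0
  rw [zero_smul, add_zero] at this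
  exact this.unique h

lemma pd_cos_phase {d : ℕ} (n : Fin d → ℤ) (i : Fin d) (x : Pt d) :
    pd i (fun y => Real.cos (phase n y)) x = -(2 * π * n i) * Real.sin (phase n x) := by
  have hp : Differentiable ℝ (phase n) := (phase_contDiff n (k := 1)).differentiable (by norm_num)
  refine pd_of_line i hp.cos x ?_
  simp_rw [phase_add]
  have h1 : HasDerivAt (fun s : ℝ => phase n x + (2 * π * n i) * s) (2 * π * n i) 0 := by
    simpa using ((hasDerivAt_id (0:ℝ)).const_mul (2 * π * (n i : ℝ))).const_add (phase n x)
  have := h1.cos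
  simp only [mul_zero, add_zero] at this
  convert this using 1
  ring

lemma pd_sin_phase {d : ℕ} (n : Fin d → ℤ) (i : Fin d) (x : Pt d) :
    pd i (fun y => Real.sin (phase n y)) x = (2 * π * n i) * Real.cos (phase n x) := by
  have hp : Differentiable ℝ (phase n) := (phase_contDiff n (k := 1)).differentiable (by norm_num)
  refine pd_of_line i hp.sin x ?_
  simp_rw [phase_add]
  have h1 : HasDerivAt (fun s : ℝ => phase n x + (2 * π * n i) * s) (2 * π * n i) 0 := by
    simpa using ((hasDerivAt_id (0:ℝ)).const_mul (2 * π * (n i : ℝ))).const_add (phase n x)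
  have := h1.sin
  simp only [mul_zero, add_zero] at this
  convert this using 1
  ring

lemma per_cos_phase {d : ℕ} (n : Fin d → ℤ) (i : Fin d) : PerI i (fun y => Real.cos (phase n y)) := by
  intro x
  have := phase_add n x i 1
  rw [one_smul] at this
  simp only [this]
  rw [← Real.cos_add_int_mul_two_pi (phase n x) (n i)]
  congr 1; ring

lemma per_sin_phase {d : ℕ} (n : Fin d → ℤ) (i : Fin d) : PerI i (fun y => Real.sin (phase n y)) := by
  intro x
  have := phase_add n x i 1
  rw [one_smul] at this
  simp only [this]
  rw [← Real.sin_add_int_mul_two_pi (phase n x) (n i)]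
  congr 1; ring

lemma coef_cos {d : ℕ} (n : Fin (d+1) → ℤ) (i : Fin (d+1)) {u : Pt (d+1) → ℝ} (hu : ContDiff ℝ 2 u)
    (hp : PerI i u) :
    ∫ y in cube (d+1), pd2 i i u y * Real.cos (phase n y)
      = -(2 * π * n i)^2 * ∫ y in cube (d+1), u y * Real.cos (phase n y) := by
  have c1 : ContDiff ℝ 1 (fun y => Real.cos (phase n y)) := (phase_contDiff n).cos
  have c2 : ContDiff ℝ 1 (fun y => Real.sin (phase n y)) := (phase_contDiff n).sin
  have h1 := by_parts i (pd_C1 i hu) c1 (((hp.pd i).mul (per_cos_phase n i)).face)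
  have h2 := by_parts i (hu.of_le (by norm_num)) c2 ((hp.mul (per_sin_phase n i)).face)
  simp_rw [pd_cos_phase] at h1
  simp_rw [pd_sin_phase] at h2
  simp_rw [mul_left_comm _ (-(2 * π * (n i : ℝ)))] at h1
  simp_rw [mul_left_comm _ ((2 * π * (n i : ℝ)))] at h2
  rw [integral_const_mul] at h1 h2
  unfold pd2
  rw [h1, h2]
  ring

lemma coef_sin {d : ℕ} (n : Fin (d+1) → ℤ) (i : Fin (d+1)) {u : Pt (d+1) → ℝ} (hu : ContDiff ℝ 2 u)
    (hp : PerI i u) :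
    ∫ y in cube (d+1), pd2 i i u y * Real.sin (phase n y)
      = -(2 * π * n i)^2 * ∫ y in cube (d+1), u y * Real.sin (phase n y) := by
  have c1 : ContDiff ℝ 1 (fun y => Real.cos (phase n y)) := (phase_contDiff n).cos
  have c2 : ContDiff ℝ 1 (fun y => Real.sin (phase n y)) := (phase_contDiff n).sin
  have h1 := by_parts i (pd_C1 i hu) c2 (((hp.pd i).mul (per_sin_phase n i)).face)
  have h2 := by_parts i (hu.of_le (by norm_num)) c1 ((hp.mul (per_cos_phase n i)).face)
  simp_rw [pd_cos_phase] at h2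
  simp_rw [pd_sin_phase] at h1
  simp_rw [mul_left_comm _ (-(2 * π * (n i : ℝ)))] at h2
  simp_rw [mul_left_comm _ ((2 * π * (n i : ℝ)))] at h1
  rw [integral_const_mul] at h1 h2
  unfold pd2
  rw [h1, h2]
  ring

/-- two-dimensional Laplacian -/
def lap2 (u : Pt 2 → ℝ) (y : Pt 2) : ℝ := pd2 0 0 u y + pd2 1 1 u y

/-- eigenvalue -/
def lam (n : Fin 2 → ℤ) : ℝ := 4*π^2*((n 0 : ℝ)^2 + (n 1 : ℝ)^2)

/-- squared modulus of the Fourier coefficient -/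
def cf (u : Pt 2 → ℝ) (n : Fin 2 → ℤ) : ℝ := (∫ y in cube 2, u y * Real.cos (phase n y))^2
      + (∫ y in cube 2, u y * Real.sin (phase n y))^2

lemma cf_comb {u : Pt 2 → ℝ} (hu : ContDiff ℝ 2 u) (h0 : PerI 0 u) (h1 : PerI 1 u) (α a : ℝ)
    (n : Fin 2 → ℤ) :
    cf (fun y => α * u y + a * lap2 u y) n = (α - a * lam n)^2 * cf u n := by
  have cu := hu.continuous
  have c0 := pd2_cont 0 0 hu
  have c1 := pd2_cont 1 1 hu
  have cp := phase_cont n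
  have key : ∀ w : Pt 2 → ℝ, Continuous w →
      (∀ i, ∫ y in cube 2, pd2 i i u y * w y = -(2 * π * n i)^2 * ∫ y in cube 2, u y * w y) →
      ∫ y in cube 2, (α * u y + a * lap2 u y) * w y
        = (α - a * lam n) * ∫ y in cube 2, u y * w y := by
    intro w hw h
    have : ∀ y, (α * u y + a * lap2 u y) * w y
      = α * (u y * w y) + (a * (pd2 0 0 u y * w y) + a * (pd2 1 1 u y * w y)) := by
      intro y; unfold lap2; ring
    simp_rw [this]
    rw [integral_add (cont_int (by fun_prop)) (cont_int (by fun_prop)),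
      integral_add (cont_int (by fun_prop)) (cont_int (by fun_prop)),
      integral_const_mul, integral_const_mul, integral_const_mul, h, h]
    unfold lam
    ring
  unfold cf
  rw [key _ (by fun_prop) (fun i => coef_cos n i hu (by fin_cases i <;> assumption)),
    key _ (by fun_prop) (fun i => coef_sin n i hu (by fin_cases i <;> assumption))]
  ring

lemma cf_nonneg (u : Pt 2 → ℝ) (n : Fin 2 → ℤ) : 0 ≤ cf u n := by unfold cf; positivity

lemma spectral2 {u : Pt 2 → ℝ} (hu : ContDiff ℝ 2 u) (h0 : PerI 0 u) (h1 : PerI 1 u) (α a κ : ℝ)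
    (hκ : ∀ n : Fin 2 → ℤ, κ * (lam n)^2 ≤ (α - a * lam n)^2) :
    κ * ∫ y in cube 2, (lap2 u y)^2 ≤ ∫ y in cube 2, (α * u y + a * lap2 u y)^2 := by
  have cu := hu.continuous
  have c0 := pd2_cont 0 0 hu
  have c1 := pd2_cont 1 1 hu
  have cl : Continuous (lap2 u) := by unfold lap2; fun_prop
  have s1 := parseval cl
  have s2 := parseval (u := fun y => α * u y + a * lap2 u y) (by fun_prop)
  refine hasSum_le ?_ (s1.mul_left κ) s2
  intro n
  change κ * cf (lap2 u) n ≤ cf (fun y => α * u y + a * lap2 u y) n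
  have e := cf_comb hu h0 h1 0 1 n
  simp only [zero_mul, zero_add, one_mul] at e
  change cf (lap2 u) n = _ at e
  rw [e, cf_comb hu h0 h1]
  have := mul_le_mul_of_nonneg_right (hκ n) (cf_nonneg u n)
  linarith

lemma lam_ge {n : Fin 2 → ℤ} (hn : n ≠ 0) : 4 * π^2 ≤ lam n := by
  unfold lam
  have : (1:ℤ) ≤ (n 0)^2 + (n 1)^2 := by
    by_contra hlt
    have h0 : n 0 = 0 := by nlinarith [sq_nonneg (n 0), sq_nonneg (n 1)]
    have h1 : n 1 = 0 := by nlinarith [sq_nonneg (n 0), sq_nonneg (n 1)]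
    apply hn
    ext i
    fin_cases i <;> simp [h0, h1]
  have h2 : (1:ℝ) ≤ (n 0 : ℝ)^2 + (n 1 : ℝ)^2 := by exact_mod_cast this
  have : 0 ≤ 4 * π^2 := by positivity
  nlinarith

lemma poincare2 {u : Pt 2 → ℝ} (hu : ContDiff ℝ 2 u) (h0 : PerI 0 u) (h1 : PerI 1 u) :
    16 * π^4 * ((∫ y in cube 2, (u y)^2) - (∫ y in cube 2, u y)^2)
      ≤ ∫ y in cube 2, (lap2 u y)^2 := by
  have cu := hu.continuous
  have c0 := pd2_cont 0 0 hu
  have c1 := pd2_cont 1 1 hu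
  have cl : Continuous (lap2 u) := by unfold lap2; fun_prop
  have s1 := parseval cl
  have s2 := parseval cu
  have s3 := hasSum_ite_eq (0 : Fin 2 → ℤ) ((∫ y in cube 2, u y)^2)
  refine hasSum_le ?_ ((s2.sub s3).mul_left (16 * π^4)) s1
  intro n
  change 16 * π^4 * (cf u n - _) ≤ cf (lap2 u) n
  have e := cf_comb hu h0 h1 0 1 n
  simp only [zero_mul, zero_add, one_mul] at e
  change cf (lap2 u) n = _ at e
  rw [e]
  by_cases hn : n = 0
  · subst hn
    have : cf u 0 = (∫ y in cube 2, u y)^2 := by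
      simp [cf, phase]
    rw [if_pos rfl, this, sub_self, mul_zero]
    positivity
  · rw [if_neg hn, sub_zero]
    refine mul_le_mul_of_nonneg_right ?_ (cf_nonneg u n)
    have := lam_ge hn
    have h4 : 0 ≤ 4 * π^2 := by positivity
    nlinarith

lemma ins_contDiff {d : ℕ} (i : Fin (d+1)) (t : ℝ) {k : WithTop ℕ∞} :
    ContDiff ℝ k (fun y : Pt d => ins i t y) := by
  rw [contDiff_pi]
  intro j
  rcases Fin.eq_self_or_eq_succAbove i j with rfl | ⟨k, rfl⟩
  · simp only [ins, Fin.insertNth_apply_same]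
    fun_prop
  · simp only [ins, Fin.insertNth_apply_succAbove]
    fun_prop

lemma ins_add {d : ℕ} (i : Fin (d+1)) (t : ℝ) (y : Pt d) (j : Fin d) (s : ℝ) :
    ins i t (y + s • Pi.single j 1) = ins i t y + s • Pi.single (i.succAbove j) 1 := by
  ext l
  rcases Fin.eq_self_or_eq_succAbove i l with rfl | ⟨k, rfl⟩
  · simp [ins, Fin.ne_succAbove]
  · simp [ins, Pi.single_apply]

lemma pd_slice {d : ℕ} (i : Fin (d+1)) (t : ℝ) (j : Fin d) {f : Pt (d+1) → ℝ}
    (hf : ContDiff ℝ 1 f) :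
    pd j (fun y => f (ins i t y)) = fun y => pd (i.succAbove j) f (ins i t y) := by
  ext y
  refine pd_of_line j ((hf.comp (ins_contDiff i t)).differentiable (by norm_num)) y ?_
  have e : (fun s : ℝ => f (ins i t (y + s • Pi.single j 1)))
      = fun s : ℝ => f (ins i t y + s • Pi.single (i.succAbove j) 1) := by
    funext s
    rw [ins_add]
  change HasDerivAt (fun s : ℝ => f (ins i t (y + s • Pi.single j 1))) _ 0
  rw [e]
  have := line_hasDeriv (i.succAbove j) (hf.differentiable (by norm_num)) (ins i t y) 0
  rw [zero_smul, add_zero] at this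
  exact this

lemma per_slice {d : ℕ} (i : Fin (d+1)) (t : ℝ) (j : Fin d) {f : Pt (d+1) → ℝ}
    (hf : PerI (i.succAbove j) f) : PerI j (fun y => f (ins i t y)) := by
  intro y
  have := ins_add i t y j 1
  rw [one_smul, one_smul] at this
  simp only [this]
  exact hf _

lemma lap_slice (t : ℝ) {f : Pt 3 → ℝ} (hf : ContDiff ℝ 2 f) (y : Pt 2) :
    lap2 (fun y => f (ins 2 t y)) y = lap' f (ins 2 t y) := by
  unfold lap2 lap' pd2
  have e0 : (2 : Fin 3).succAbove 0 = 0 := by decide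
  have e1 : (2 : Fin 3).succAbove 1 = 1 := by decide
  rw [pd_slice 2 t 0 (hf.of_le (by norm_num)), pd_slice 2 t 1 (hf.of_le (by norm_num)),
    pd_slice 2 t 0 (pd_C1 _ hf), pd_slice 2 t 1 (pd_C1 _ hf), e0, e1]

lemma lap_cont {f : Pt 3 → ℝ} (hf : ContDiff ℝ 2 f) : Continuous (lap' f) := by
  have c0 := pd2_cont 0 0 hf
  have c1 := pd2_cont 1 1 hf
  unfold lap'
  fun_prop

lemma spectral3 {f : Pt 3 → ℝ} (hf : ContDiff ℝ 2 f) (h0 : PerI 0 f) (h1 : PerI 1 f) (α a κ : ℝ)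
    (hκ : ∀ n : Fin 2 → ℤ, κ * (lam n)^2 ≤ (α - a * lam n)^2) :
    κ * ∫ y in cube 3, (lap' f y)^2 ≤ ∫ y in cube 3, (α * f y + a * lap' f y)^2 := by
  have cf := hf.continuous
  have cl := lap_cont hf
  have k1 : Continuous fun y => (lap' f y)^2 := by fun_prop
  have k2 : Continuous fun y => (α * f y + a * lap' f y)^2 := by fun_prop
  rw [cube_fubini 2 k1, cube_fubini 2 k2, ← intervalIntegral.integral_const_mul]
  refine intervalIntegral.integral_mono_on zero_le_one
    (((inner_cont 2 k1).const_smul κ).intervalIntegrable _ _)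
    ((inner_cont 2 k2).intervalIntegrable _ _) ?_
  intro t _
  have := spectral2 (u := fun y => f (ins 2 t y)) (hf.comp (ins_contDiff 2 t))
    (per_slice 2 t 0 h0) (per_slice 2 t 1 h1) α a κ hκ
  simpa only [lap_slice t hf] using this

lemma poincare3 {f : Pt 3 → ℝ} (hf : ContDiff ℝ 2 f) (h0 : PerI 0 f) (h1 : PerI 1 f) :
    16 * π^4 * ((∫ y in cube 3, (f y)^2) - (∫ y in cube 3, f y)^2 - ∫ y in cube 3, (pd 2 f y)^2)
      ≤ ∫ y in cube 3, (lap' f y)^2 := by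
  have cf := hf.continuous
  have cl := lap_cont hf
  have k1 : Continuous fun y => (lap' f y)^2 := by fun_prop
  have k2 : Continuous fun y => (f y)^2 := by fun_prop
  have hm := mean_est 2 (hf.of_le (by norm_num : (1 : WithTop ℕ∞) ≤ 2))
  have k3 : Continuous fun t => (∫ y in cube 2, f (ins 2 t y))^2 := (inner_cont 2 cf).pow 2
  have hmain : 16 * π^4 * ((∫ y in cube 3, (f y)^2) - ∫ t in (0:ℝ)..1, (∫ y in cube 2, f (ins 2 t y))^2)
      ≤ ∫ y in cube 3, (lap' f y)^2 := by
    rw [cube_fubini 2 k1, cube_fubini 2 k2, ← intervalIntegral.integral_sub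
      ((inner_cont 2 k2).intervalIntegrable _ _) (k3.intervalIntegrable _ _),
      ← intervalIntegral.integral_const_mul]
    refine intervalIntegral.integral_mono_on zero_le_one
      ((((inner_cont 2 k2).sub k3).const_smul (16 * π^4)).intervalIntegrable _ _)
      ((inner_cont 2 k1).intervalIntegrable _ _) ?_
    intro t _
    have := poincare2 (u := fun y => f (ins 2 t y)) (hf.comp (ins_contDiff 2 t))
      (per_slice 2 t 0 h0) (per_slice 2 t 1 h1)
    simpa only [lap_slice t hf] using this
  refine le_trans ?_ hmain
  refine mul_le_mul_of_nonneg_left ?_ (by positivity)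
  linarith

lemma pd_sub_const {d : ℕ} (i : Fin d) (f : Pt d → ℝ) (m : ℝ) :
    pd i (fun x => f x - m) = pd i f := by
  ext x
  unfold pd
  rw [fderiv_sub_const]

lemma H2_expand {d : Pt 3 → ℝ} (hf : ContDiff ℝ 2 d) (m : ℝ) :
    H2normSq (fun x => d x - m) = (∫ x in cube 3, (d x - m)^2)
      + ∑ i, (∫ x in cube 3, (pd i d x)^2) + ∑ i, ∑ j, ∫ x in cube 3, (pd2 i j d x)^2 := by
  unfold H2normSq
  have c := hf.continuous
  have c1 : ∀ i, Continuous (pd i d) := fun i => (pd_C1 i hf).continuous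
  have c2 : ∀ i j, Continuous (pd2 i j d) := fun i j => pd2_cont i j hf
  have e2 : ∀ i j, pd2 i j (fun x => d x - m) = pd2 i j d := by
    intro i j; unfold pd2; rw [pd_sub_const]
  simp_rw [pd_sub_const, e2]
  rw [integral_add (cont_int (by fun_prop)) (cont_int (by fun_prop)),
    integral_add (cont_int (by fun_prop)) (cont_int (by fun_prop)), integral_finsetSum,
    integral_finsetSum]
  · congr 1
    refine Finset.sum_congr rfl fun i _ => ?_
    rw [integral_finsetSum]
    intro j _
    exact cont_int (by fun_prop)
  · intro i _
    exact cont_int (by fun_prop)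
  · intro i _
    exact cont_int (by fun_prop)

lemma memV_face {m : ℝ} {f : Pt 3 → ℝ} (h : MemV m f) (y : Pt 2) :
    pd 2 f (ins 2 1 y) = 0 ∧ pd 2 f (ins 2 0 y) = 0 :=
  ⟨h.bc _ (Or.inr (by simp [ins])), h.bc _ (Or.inl (by simp [ins]))⟩

lemma memV_per {m : ℝ} {f : Pt 3 → ℝ} (h : MemV m f) : PerI 0 f ∧ PerI 1 f :=
  ⟨fun x => (h.periodic x).1, fun x => (h.periodic x).2⟩

lemma grad_est {m : ℝ} {f : Pt 3 → ℝ} (h : MemV m f) (i : Fin 3) (m' : ℝ) :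
    ∫ x in cube 3, pd2 i i f x * (f x - m') = - ∫ x in cube 3, (pd i f x)^2 := by
  have hf := h.smooth
  have c1 : ContDiff ℝ 1 (fun x => f x - m') := (hf.of_le (by norm_num)).sub contDiff_const
  have hsub : ∀ i, PerI i f → PerI i (fun x => f x - m') := by
    intro i hi x
    simp only [hi x]
  have hb : ∀ y, pd i f (ins i 1 y) * (f (ins i 1 y) - m')
      = pd i f (ins i 0 y) * (f (ins i 0 y) - m') := by
    intro y
    fin_cases i
    · exact (((memV_per h).1.pd 0).mul (hsub 0 (memV_per h).1)).face y
    · exact (((memV_per h).2.pd 1).mul (hsub 1 (memV_per h).2)).face y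
    · have := memV_face h y
      simp [this.1, this.2]
  have := by_parts i (pd_C1 i hf) c1 hb
  rw [pd_sub_const] at this
  simp_rw [← sq] at this
  exact this

lemma grad_le {m : ℝ} {f : Pt 3 → ℝ} (h : MemV m f) (i : Fin 3) :
    ∫ x in cube 3, (pd i f x)^2 ≤ (1/2) * (∫ x in cube 3, (f x - m)^2)
      + (1/2) * ∫ x in cube 3, (pd2 i i f x)^2 := by
  have hf := h.smooth
  have c := hf.continuous
  have c2 := pd2_cont i i hf
  have e := grad_est h i m
  rw [← integral_const_mul, ← integral_const_mul,
    ← integral_add (cont_int (by fun_prop)) (cont_int (by fun_prop)), ← neg_neg (∫ x in cube 3, (pd i f x)^2),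
    ← e, ← integral_neg]
  refine setIntegral_mono (cont_int (by fun_prop)) (cont_int (by fun_prop)) ?_
  intro x
  simp only
  nlinarith [sq_nonneg (pd2 i i f x + (f x - m))]

lemma hess2 {m : ℝ} {f : Pt 3 → ℝ} (h : MemV m f) (i : Fin 3) (hi : PerI i f) :
    ∫ x in cube 3, pd2 i i f x * pd2 2 2 f x = ∫ x in cube 3, (pd2 2 i f x)^2 := by
  refine hess_identity i 2 h.smooth hi ?_
  intro s y
  have := memV_face h y
  simp [this.1, this.2]

lemma hess01 {m : ℝ} {f : Pt 3 → ℝ} (h : MemV m f) :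
    ∫ x in cube 3, pd2 0 0 f x * pd2 1 1 f x = ∫ x in cube 3, (pd2 1 0 f x)^2 := by
  refine hess_identity 0 1 h.smooth (memV_per h).1 ?_
  intro s y
  exact ((((memV_per h).2.pd 0).shift (s • Pi.single 0 1)).mul ((memV_per h).2.pd 1)).face y

lemma prod_le {u v : Pt 3 → ℝ} (hu : Continuous u) (hv : Continuous v) :
    ∫ x in cube 3, u x * v x ≤ (1/2) * (∫ x in cube 3, (u x)^2) + (1/2) * ∫ x in cube 3, (v x)^2 := by
  rw [← integral_const_mul, ← integral_const_mul,
    ← integral_add (cont_int (by fun_prop)) (cont_int (by fun_prop))]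
  refine setIntegral_mono (cont_int (by fun_prop)) (cont_int (by fun_prop)) ?_
  intro x
  simp only
  nlinarith [sq_nonneg (u x - v x)]

lemma sq_nn (g : Pt 3 → ℝ) : 0 ≤ ∫ x in cube 3, (g x)^2 := integral_nonneg (fun _ => sq_nonneg _)

/-- all H² norms are controlled -/
lemma H2_bound {m : ℝ} {f : Pt 3 → ℝ} (h : MemV m f) :
    H2normSq (fun x => f x - m) ≤ 5 * (∫ x in cube 3, (lap' f x)^2) + 6 * ∫ x in cube 3, (pd2 2 2 f x)^2 := by
  have hf := h.smooth
  have c := hf.continuous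
  have c2 : ∀ i j, Continuous (pd2 i j f) := fun i j => pd2_cont i j hf
  rw [H2_expand hf]
  simp only [Fin.sum_univ_three]
  rw [pd2_symm 0 1 hf, pd2_symm 0 2 hf, pd2_symm 1 2 hf]
  have p := poincare3 hf (memV_per h).1 (memV_per h).2
  rw [h.mass] at p
  have hD : ∫ x in cube 3, (pd 2 f x)^2 ≤ ∫ x in cube 3, (pd2 2 2 f x)^2 :=
    poincare0 2 (pd_C1 2 hf) (fun y => (memV_face h y).2)
  have hvar : ∫ x in cube 3, (f x - m)^2 = (∫ x in cube 3, (f x)^2) - m^2 := by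
    have : ∀ x, (f x - m)^2 = (f x)^2 - 2 * m * f x + m^2 := fun x => by ring
    simp_rw [this]
    rw [integral_add (cont_int (by fun_prop)) (cont_int (by fun_prop)),
      integral_sub (cont_int (by fun_prop)) (cont_int (by fun_prop)), integral_const_mul, h.mass,
      integral_const]
    simp
    ring
  have hX : ∫ x in cube 3, (lap' f x)^2 = (∫ x in cube 3, (pd2 0 0 f x)^2)
      + 2 * (∫ x in cube 3, (pd2 1 0 f x)^2) + ∫ x in cube 3, (pd2 1 1 f x)^2 := by
    rw [← hess01 h]
    have : ∀ x, (lap' f x)^2 = (pd2 0 0 f x)^2 + 2 * (pd2 0 0 f x * pd2 1 1 f x) + (pd2 1 1 f x)^2 := by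
      intro x; unfold lap'; ring
    simp_rw [this]
    rw [integral_add (cont_int (by fun_prop)) (cont_int (by fun_prop)),
      integral_add (cont_int (by fun_prop)) (cont_int (by fun_prop)), integral_const_mul]
  have g0 := grad_le h 0
  have g1 := grad_le h 1
  have q0 := prod_le (c2 0 0) (c2 2 2)
  have q1 := prod_le (c2 1 1) (c2 2 2)
  rw [hess2 h 0 (memV_per h).1] at q0
  rw [hess2 h 1 (memV_per h).2] at q1
  have n1 := sq_nn (pd2 1 0 f)
  have nX := sq_nn (lap' f)
  have hpi : (1:ℝ) ≤ π^4 := one_le_pow₀ (by linarith [Real.pi_gt_three])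
  have hψ : ∫ x in cube 3, (f x - m)^2 ≤ (∫ x in cube 3, (lap' f x)^2) + ∫ x in cube 3, (pd2 2 2 f x)^2 := by
    rw [hvar]
    by_contra hlt
    push Not at hlt
    have h1 : 0 ≤ (∫ y in cube 3, (f y)^2) - m^2 - ∫ y in cube 3, (pd 2 f y)^2 := by linarith
    nlinarith
  linarith

lemma energy_lower {m α : ℝ} {W : ℝ → ℝ} {Cα c : ℝ} (hWcont : Continuous W)
    (hWlow : ∀ t : ℝ, W t ≥ -Cα * t^2 - c) (L h : ℝ) {f : Pt 3 → ℝ} (hV : MemV m f) :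
    FLh α W L h f ≥ (1/2) * (∫ x in cube 3, (α * f x + (1/L^2) * lap' f x)^2)
      - (1/(L^2*h^2)) * α * (∫ x in cube 3, (pd 2 f x)^2)
      + (1/2) * (1/(L^2*h^2))^2 * (∫ x in cube 3, (pd2 2 2 f x)^2)
      - Cα * (∫ x in cube 3, (f x)^2) - c := by
  have hf := hV.smooth
  have cf := hf.continuous
  have c2 : ∀ i j, Continuous (pd2 i j f) := fun i j => pd2_cont i j hf
  have cl := lap_cont hf
  unfold FLh
  have ha : 0 ≤ 1/L^2 := by positivity
  have hb : 0 ≤ 1/(L^2*h^2) := by positivity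
  set a := 1/L^2
  set b := 1/(L^2*h^2)
  have h1 : ∫ x in cube 3, ((1/2) * (α * f x + a * lap' f x)^2 + (b * α * (pd2 2 2 f x * f x)
      + (a * b * (pd2 0 0 f x * pd2 2 2 f x) + (a * b * (pd2 1 1 f x * pd2 2 2 f x)
      + ((1/2) * b^2 * (pd2 2 2 f x)^2 + (- Cα * (f x)^2 + -c))))))
      ≤ ∫ x in cube 3, ((1/2) * (α * f x + a * lap' f x + b * pd2 2 2 f x)^2 + W (f x)) := by
    refine setIntegral_mono (cont_int (by fun_prop)) (cont_int (by fun_prop)) ?_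
    intro x
    have := hWlow (f x)
    simp only
    have e : (1/2) * (α * f x + a * lap' f x + b * pd2 2 2 f x)^2
      = (1/2) * (α * f x + a * lap' f x)^2 + (b * α * (pd2 2 2 f x * f x)
      + (a * b * (pd2 0 0 f x * pd2 2 2 f x) + (a * b * (pd2 1 1 f x * pd2 2 2 f x)
      + ((1/2) * b^2 * (pd2 2 2 f x)^2)))) := by
      unfold lap'; ring
    rw [e]
    linarith
  have g := grad_est hV 2 0
  simp only [sub_zero] at g
  rw [integral_add (cont_int (by fun_prop)) (cont_int (by fun_prop)),
    integral_add (cont_int (by fun_prop)) (cont_int (by fun_prop)),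
    integral_add (cont_int (by fun_prop)) (cont_int (by fun_prop)),
    integral_add (cont_int (by fun_prop)) (cont_int (by fun_prop)),
    integral_add (cont_int (by fun_prop)) (cont_int (by fun_prop)),
    integral_add (cont_int (by fun_prop)) (cont_int (by fun_prop)),
    integral_const_mul, integral_const_mul, integral_const_mul, integral_const_mul,
    integral_const_mul, integral_const_mul, hess2 hV 0 (memV_per hV).1, hess2 hV 1 (memV_per hV).2,
    g, integral_const] at h1
  simp only [probReal_univ, one_smul] at h1
  have n0 := mul_nonneg (mul_nonneg ha hb) (sq_nn (pd2 2 0 f))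
  have n1 := mul_nonneg (mul_nonneg ha hb) (sq_nn (pd2 2 1 f))
  linarith

/-- uniform spectral gap -/
lemma gap {α q a : ℝ} (hq : 0 < q)
    (hqle : ∀ k : ℤ × ℤ, k ≠ 0 → q ≤ (α / (4*π^2*((k.1 : ℝ)^2 + (k.2 : ℝ)^2)) - 1)^2)
    (ha : |a - 1| ≤ √q / 2) (n : Fin 2 → ℤ) : (q/4) * (lam n)^2 ≤ (α - a * lam n)^2 := by
  by_cases hn : n = 0
  · subst hn
    have : lam 0 = 0 := by simp [lam]
    rw [this]
    nlinarith [sq_nonneg α]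
  have hl : 0 < lam n := lt_of_lt_of_le (by positivity) (lam_ge hn)
  have hk : ((n 0, n 1) : ℤ × ℤ) ≠ 0 := by
    intro h
    apply hn
    obtain ⟨h0, h1⟩ := Prod.mk_eq_zero.1 h
    ext i
    fin_cases i <;> simp [h0, h1]
  have h1 : q ≤ (α / lam n - 1)^2 := by
    have := hqle (n 0, n 1) hk
    unfold lam
    simpa using this
  have h2 : √q ≤ |α / lam n - 1| := by
    rw [← Real.sqrt_sq_eq_abs]
    exact Real.sqrt_le_sqrt h1
  have h3 : √q / 2 ≤ |α / lam n - a| := by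
    have : |α / lam n - 1| ≤ |α / lam n - a| + |a - 1| := abs_sub_le _ _ _
    linarith
  have h4 : (√q / 2)^2 ≤ (α / lam n - a)^2 := by
    rw [← sq_abs (α / lam n - a)]
    exact pow_le_pow_left₀ (by positivity) h3 2
  have h5 : (√q / 2)^2 = q / 4 := by
    rw [div_pow, Real.sq_sqrt hq.le]; norm_num
  rw [h5] at h4
  have h6 : α - a * lam n = (α / lam n - a) * lam n := by
    field_simp
  rw [h6, mul_pow]
  exact mul_le_mul_of_nonneg_right h4 (sq_nonneg _)

/-- final real arithmetic -/
lemma final_arith {α q Cα c m b hh A X Z D p F H : ℝ} (hq : 0 < q) (hCα : 0 < Cα)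
    (hCq : Cα < 2 * π^2 * q) (hX : 0 ≤ X) (hD : 0 ≤ D) (hDZ : D ≤ Z)
    (hb1 : 4 * |α| + 8 * Cα + 8 ≤ b) (hhh : 1 ≤ hh) (hb2 : hh ≤ 6 * b^2)
    (hP : 16 * π^4 * (A - m^2 - D) ≤ X) (hS : q/4 * X ≤ p)
    (hF : (1/2) * p - b * α * D + (1/2) * b^2 * Z - Cα * A - c ≤ F)
    (hH : H ≤ 5 * X + 6 * Z) :
    min (q/100) (1/1000) * (H + hh * D) - (Cα * m^2 + c) ≤ F := by
  have hpi : 9 ≤ π^2 := by nlinarith [Real.pi_gt_three]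
  have hZ : 0 ≤ Z := hD.trans hDZ
  have hb0 : 0 ≤ b := by nlinarith [abs_nonneg α]
  -- Cα (A - m² - D) ≤ q X / 72
  have k1 : Cα * (A - m^2 - D) ≤ q/72 * X := by
    by_cases hs : A - m^2 - D ≤ 0
    · have := mul_nonneg hq.le hX
      have := mul_nonneg hCα.le (neg_nonneg.2 hs)
      linarith
    · push Not at hs
      have t1 : Cα * (A - m^2 - D) ≤ 2 * π^2 * q * (A - m^2 - D) :=
        mul_le_mul_of_nonneg_right hCq.le hs.le
      have t2 : 2 * π^2 * q * (A - m^2 - D) * 72 ≤ q * X := by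
        have t3 : q * (16 * π^4 * (A - m^2 - D)) ≤ q * X := mul_le_mul_of_nonneg_left hP hq.le
        have t4 : 0 ≤ (π^2 - 9) * (16 * π^2 * (q * (A - m^2 - D))) := by
          have := mul_pos hq hs
          have : 0 ≤ π^2 - 9 := by linarith
          positivity
        nlinarith
      linarith
  have k2 : b * α * D ≤ (1/4) * b^2 * Z := by
    have t1 : α ≤ b / 4 := by nlinarith [le_abs_self α, abs_nonneg α]
    have t2 : b * α * D ≤ b * (b/4) * D :=
      mul_le_mul_of_nonneg_right (mul_le_mul_of_nonneg_left t1 hb0) hD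
    have t3 : b * (b/4) * D ≤ b * (b/4) * Z := mul_le_mul_of_nonneg_left hDZ (by positivity)
    linarith
  have k3 : Cα * D ≤ (1/8) * b^2 * Z := by
    have t1 : Cα ≤ (1/8) * b^2 := by nlinarith [abs_nonneg α]
    have : Cα * D ≤ (1/8) * b^2 * D := mul_le_mul_of_nonneg_right t1 hD
    have : (1/8) * b^2 * D ≤ (1/8) * b^2 * Z := mul_le_mul_of_nonneg_left hDZ (by positivity)
    linarith
  have k4 : hh * Z ≤ 6 * b^2 * Z := mul_le_mul_of_nonneg_right hb2 hZ
  have k5 : Z ≤ hh * Z := by nlinarith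
  have k6 : hh * D ≤ hh * Z := mul_le_mul_of_nonneg_left hDZ (by linarith)
  have low : q/16 * X + (1/48) * (hh * Z) - (Cα * m^2 + c) ≤ F := by nlinarith
  set C := min (q/100) (1/1000) with hC
  have C0 : 0 ≤ C := by rw [hC]; positivity
  have C1 : C ≤ q/100 := min_le_left _ _
  have C2 : C ≤ 1/1000 := min_le_right _ _
  have s1 : C * (H + hh * D) ≤ C * (5 * X + 7 * (hh * Z)) :=
    mul_le_mul_of_nonneg_left (by linarith) C0
  have s2 : C * X ≤ q/100 * X := mul_le_mul_of_nonneg_right C1 hX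
  have s3 : C * (hh * Z) ≤ 1/1000 * (hh * Z) := mul_le_mul_of_nonneg_right C2 (by nlinarith)
  have : 0 ≤ q * X := by positivity
  nlinarith

/-- Remark 2.2.2 (generalized coercivity). -/
theorem coercivity_general (m α : ℝ) (W : ℝ → ℝ) (Cα c : ℝ)
    (hα : AlphaAdmissible α) (hWcont : Continuous W)
    (hCα : 0 < Cα) (hc : 0 < c)
    (hWlow : ∀ t : ℝ, W t ≥ -Cα * t^2 - c)
    (hCαsmall : Cα < 2*π^2 *
      sInf {t : ℝ | ∃ k : ℤ × ℤ, k ≠ 0 ∧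
        t = (α / (4*π^2*((k.1 : ℝ)^2 + (k.2 : ℝ)^2)) - 1)^2}) :
    ∃ C ε h₀ C' : ℝ, 0 < C ∧ 0 < ε ∧ 0 < h₀ ∧ 0 ≤ C' ∧
      ∀ L ∈ Set.Ioo (1 - ε) (1 + ε), ∀ h ∈ Set.Ioo (0:ℝ) h₀, ∀ φ : Pt 3 → ℝ, MemV m φ →
        FLh α W L h φ ≥
          C * (H2normSq (fun x => φ x - m) + (1/h^4) * ∫ x in cube 3, (pd 2 φ x)^2)
            - C' := by
  set S := {t : ℝ | ∃ k : ℤ × ℤ, k ≠ 0 ∧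
        t = (α / (4*π^2*((k.1 : ℝ)^2 + (k.2 : ℝ)^2)) - 1)^2} with hS
  set q := sInf S with hqdef
  have hq : 0 < q := by
    have h1 : 0 < 2*π^2 * q := hCα.trans hCαsmall
    exact pos_of_mul_pos_right h1 (by positivity)
  have hbdd : BddBelow S := ⟨0, by rintro t ⟨k, _, rfl⟩; positivity⟩
  have hqle : ∀ k : ℤ × ℤ, k ≠ 0 → q ≤ (α / (4*π^2*((k.1 : ℝ)^2 + (k.2 : ℝ)^2)) - 1)^2 :=
    fun k hk => csInf_le hbdd ⟨k, hk, rfl⟩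
  have hsq : 0 < √q := Real.sqrt_pos.2 hq
  set B := 1 + |α| + Cα with hB
  have hB1 : 1 ≤ B := by have := abs_nonneg α; linarith
  refine ⟨min (q/100) (1/1000), min (1/2) (√q/20), 1/(10*B), Cα * m^2 + c, by positivity,
    by positivity, by positivity, by positivity, ?_⟩
  intro L hL h hh φ hV
  have hε1 : min (1/2) (√q/20) ≤ 1/2 := min_le_left _ _
  have hε2 : min (1/2) (√q/20) ≤ √q/20 := min_le_right _ _
  have hL1 : 1/2 < L := by linarith [hL.1]
  have hL2 : L < 3/2 := by linarith [hL.2]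
  have hLa : |L - 1| ≤ √q/20 := by
    rw [abs_le]; constructor <;> linarith [hL.1, hL.2]
  have hLpos : 0 < L := by linarith
  have ha : |1/L^2 - 1| ≤ √q/2 := by
    have e : 1/L^2 - 1 = (L - 1) * (-(L+1)/L^2) := by field_simp; ring
    have h2 : |(-(L+1)/L^2)| ≤ 10 := by
      rw [abs_div, abs_neg, abs_of_pos (by linarith : 0 < L + 1), abs_of_pos (by positivity : 0 < L^2),
        div_le_iff₀ (by positivity)]
      nlinarith
    rw [e, abs_mul]
    have := mul_le_mul hLa h2 (abs_nonneg _) (by positivity)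
    linarith
  have hf := hV.smooth
  have hper := memV_per hV
  have hS3 := spectral3 hf hper.1 hper.2 α (1/L^2) (q/4) (gap hq hqle ha)
  have hP := poincare3 hf hper.1 hper.2
  rw [hV.mass] at hP
  have hDZ : ∫ x in cube 3, (pd 2 φ x)^2 ≤ ∫ x in cube 3, (pd2 2 2 φ x)^2 :=
    poincare0 2 (pd_C1 2 hf) (fun y => (memV_face hV y).2)
  have hpos : 0 < h := hh.1
  have hy : 100 * B ≤ 1/h^2 := by
    have h1 : 10 * B ≤ 1/h := by
      rw [le_div_iff₀ hpos]
      have := hh.2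
      rw [lt_div_iff₀ (by positivity)] at this
      linarith
    have h2 : (10 * B)^2 ≤ (1/h)^2 := pow_le_pow_left₀ (by positivity) h1 2
    rw [one_div_pow] at h2
    nlinarith
  have hLy : 1/(L^2*h^2) = (1/L^2) * (1/h^2) := by rw [one_div_mul_one_div]
  have hLa2 : 4/9 ≤ 1/L^2 := by
    rw [div_le_div_iff₀ (by norm_num) (by positivity)]
    nlinarith
  have hy4 : 1/h^4 = (1/h^2)^2 := by rw [one_div_pow]; ring
  have hb : 4/9 * (1/h^2) ≤ 1/(L^2*h^2) := by
    rw [hLy]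
    exact mul_le_mul_of_nonneg_right hLa2 (by positivity)
  have hα0 := abs_nonneg α
  refine final_arith (b := 1/(L^2*h^2)) hq hCα hCαsmall (sq_nn _) (sq_nn _) hDZ ?_ ?_ ?_ hP hS3
    (energy_lower hWcont hWlow L h hV) (H2_bound hV)
  · linarith
  · rw [hy4]
    exact one_le_pow₀ (by linarith)
  · rw [hy4]
    have h2 : (4/9 * (1/h^2))^2 ≤ (1/(L^2*h^2))^2 := pow_le_pow_left₀ (by positivity) hb 2
    rw [mul_pow] at h2
    have : 0 ≤ (1/h^2)^2 := sq_nonneg _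
    linarith

end
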